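/- Let k, n be positive integers with k < n, and let p₀,…,p_k ∈ ℝ^{1,n} be (k+1) points in general position. Then the Lorentzian distance-squared mapping L_{(p₀,…,p_k)} : ℝ^{1,n} → ℝ^{k+1} is A-equivalent to the normal form of definite fold mapping Φ_k if and only if the recognition subspace V(p₀,…,p_k) is time-like. -/

import Mathlib

open scoped BigOperators

noncomputable section

/-- The Lorentzian inner product on `ℝ^{1,n}`, modeled as `Fin (n+1) → ℝ`:
`⟨x,y⟩ = -x₀y₀ + x₁y₁ + ⋯ + xₙyₙ`. -/
def lorIP {n : ℕ} (x y : Fin (n + 1) → ℝ) : ℝ :=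
  (∑ i, x i * y i) - 2 * (x 0 * y 0)

/-- The Euclidean inner product on `Fin m → ℝ`. -/
def eucIP {m : ℕ} (x y : Fin m → ℝ) : ℝ := ∑ i, x i * y i

/-- The Lorentzian distance-squared mapping determined by the points `p 0, …, p (m-1)`. -/
def LorDSM {n m : ℕ} (p : Fin m → Fin (n + 1) → ℝ) :
    (Fin (n + 1) → ℝ) → (Fin m → ℝ) :=
  fun x i => lorIP (x - p i) (x - p i)

/-- The Euclidean distance-squared mapping determined by the points `p 0, …, p (m-1)`. -/
def EucDSM {n m : ℕ} (p : Fin m → Fin (n + 1) → ℝ) :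
    (Fin (n + 1) → ℝ) → (Fin m → ℝ) :=
  fun x i => eucIP (x - p i) (x - p i)

/-- The recognition subspace `V(p₀, …, p_k)`: the span of the vectors `p i - p 0`. -/
def recSub {n k : ℕ} (p : Fin (k + 1) → Fin (n + 1) → ℝ) :
    Submodule ℝ (Fin (n + 1) → ℝ) :=
  Submodule.span ℝ (Set.range fun i => p i - p 0)

/-- The partial recognition subspace `V(p₀, …, p_j)`: the span of `p i - p 0` for `i ≤ j`. -/
def recSubUpTo {n k : ℕ} (p : Fin (k + 1) → Fin (n + 1) → ℝ) (j : ℕ) :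
    Submodule ℝ (Fin (n + 1) → ℝ) :=
  Submodule.span ℝ {v | ∃ i : Fin (k + 1), (i : ℕ) ≤ j ∧ v = p i - p 0}

/-- A subspace is time-like iff it contains a vector of negative Lorentzian square. -/
def LTimeLike {n : ℕ} (V : Submodule ℝ (Fin (n + 1) → ℝ)) : Prop :=
  ∃ v ∈ V, lorIP v v < 0

/-- A subspace is space-like iff every nonzero vector in it has positive Lorentzian square. -/
def LSpaceLike {n : ℕ} (V : Submodule ℝ (Fin (n + 1) → ℝ)) : Prop :=
  ∀ v ∈ V, v ≠ 0 → 0 < lorIP v v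

/-- A subspace is light-like iff it is neither time-like nor space-like. -/
def LLightLike {n : ℕ} (V : Submodule ℝ (Fin (n + 1) → ℝ)) : Prop :=
  ¬ LTimeLike V ∧ ¬ LSpaceLike V

/-- `f` and `g` are `𝒜`-equivalent: `g = H ∘ f ∘ h` for `C^∞` diffeomorphisms `h, H`. -/
def AEquiv {a b : ℕ} (f g : (Fin a → ℝ) → (Fin b → ℝ)) : Prop :=
  ∃ (h : (Fin a → ℝ) ≃ (Fin a → ℝ)) (H : (Fin b → ℝ) ≃ (Fin b → ℝ)),
    ContDiff ℝ (⊤ : ℕ∞) ⇑h ∧ ContDiff ℝ (⊤ : ℕ∞) ⇑h.symm ∧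
    ContDiff ℝ (⊤ : ℕ∞) ⇑H ∧ ContDiff ℝ (⊤ : ℕ∞) ⇑H.symm ∧
    g = ⇑H ∘ f ∘ ⇑h

open Module

/-- The Lorentzian inner product as a bilinear form. -/
def lorForm (n : ℕ) : LinearMap.BilinForm ℝ (Fin (n + 1) → ℝ) :=
  LinearMap.mk₂ ℝ lorIP
    (fun x y z => by
      simp only [lorIP, Pi.add_apply, add_mul, Finset.sum_add_distrib]; ring)
    (fun c x y => by
      simp only [lorIP, Pi.smul_apply, smul_eq_mul, mul_assoc, ← Finset.mul_sum]; ring)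
    (fun x y z => by
      simp only [lorIP, Pi.add_apply, mul_add, Finset.sum_add_distrib]; ring)
    (fun c x y => by
      simp only [lorIP, Pi.smul_apply, smul_eq_mul, mul_left_comm _ c, ← Finset.mul_sum]; ring)

lemma lorForm_apply {n : ℕ} (x y : Fin (n + 1) → ℝ) : lorForm n x y = lorIP x y := rfl

lemma lorIP_eq_sum_succ {n : ℕ} (x y : Fin (n + 1) → ℝ) :
    lorIP x y = (∑ i : Fin n, x i.succ * y i.succ) - x 0 * y 0 := by
  rw [lorIP, Fin.sum_univ_succ]; ring

lemma lorForm_comm {n : ℕ} (x y : Fin (n + 1) → ℝ) : lorForm n x y = lorForm n y x := by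
  simp only [lorForm_apply, lorIP, mul_comm]

lemma lorForm_isSymm (n : ℕ) : (lorForm n).IsSymm := ⟨fun x y => lorForm_comm x y⟩

lemma lorForm_isRefl (n : ℕ) : (lorForm n).IsRefl := (lorForm_isSymm n).isRefl

lemma eq_zero_of_lorForm_eq_zero {n : ℕ} (x : Fin (n + 1) → ℝ)
    (hx : ∀ y, lorForm n x y = 0) : x = 0 := by
  funext i
  have h := hx (Pi.single i 1)
  rw [lorForm_apply, lorIP_eq_sum_succ] at h
  cases i using Fin.cases with
  | zero => simpa using h
  | succ j => simpa [Pi.single_apply] using h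

lemma lorForm_nondegenerate (n : ℕ) : (lorForm n).Nondegenerate :=
  ⟨eq_zero_of_lorForm_eq_zero,
    fun y hy => eq_zero_of_lorForm_eq_zero y fun x => by rw [lorForm_comm, hy]⟩

/-- The reversed Cauchy-Schwarz argument: what is orthogonal to a time-like vector is space-like. -/
lemma lorIP_self_pos_of_orthogonal {n : ℕ} {v w : Fin (n + 1) → ℝ} (hv : lorIP v v < 0)
    (hvw : lorIP v w = 0) (hw : w ≠ 0) : 0 < lorIP w w := by
  rw [lorIP_eq_sum_succ] at *
  have cs := Finset.sum_mul_sq_le_sq_mul_sq Finset.univ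
    (fun i : Fin n => v i.succ) (fun i : Fin n => w i.succ)
  simp only [← pow_two] at *
  set a := ∑ i : Fin n, v i.succ ^ 2
  set b := ∑ i : Fin n, w i.succ ^ 2
  have ha0 : 0 ≤ a := Finset.sum_nonneg fun i _ => sq_nonneg _
  have hb0 : 0 ≤ b := Finset.sum_nonneg fun i _ => sq_nonneg _
  have hv0 : 0 < v 0 ^ 2 := by linarith
  rw [sub_eq_zero.1 hvw] at cs
  rcases hb0.eq_or_lt with h | h
  · exfalso
    apply hw
    have hs : ∀ i : Fin n, w i.succ = 0 := fun i => by
      have := (Finset.sum_eq_zero_iff_of_nonneg (fun i _ => sq_nonneg _)).1 h.symm i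
        (Finset.mem_univ i)
      exact pow_eq_zero_iff two_ne_zero |>.1 this
    have h0 : w 0 = 0 := by
      rw [← h, mul_zero, mul_pow] at cs
      have := nonneg_of_mul_nonneg_right (a := v 0 ^ 2) (b := - w 0 ^ 2) (by linarith) hv0
      exact pow_eq_zero_iff two_ne_zero |>.1 (le_antisymm (by linarith) (sq_nonneg _))
    funext i
    exact Fin.cases h0 hs i
  · have : v 0 ^ 2 * w 0 ^ 2 < v 0 ^ 2 * b := by nlinarith
    have := lt_of_mul_lt_mul_left this hv0.le
    linarith

/-- A subspace is time-like if its orthogonal complement has dimension at least two and contains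
no nonzero null vector. -/
lemma lTimeLike_of_orthogonal_anisotropic {n : ℕ} (V : Submodule ℝ (Fin (n + 1) → ℝ))
    (hV : 2 ≤ finrank ℝ ((lorForm n).orthogonal V))
    (h : ∀ u ∈ (lorForm n).orthogonal V, lorIP u u = 0 → u = 0) : LTimeLike V := by
  set W := (lorForm n).orthogonal V
  obtain ⟨a, haW, ha0, ha⟩ : ∃ a ∈ W, a 0 = 0 ∧ a ≠ 0 := by
    have hlt : finrank ℝ ℝ < finrank ℝ W := by rw [finrank_self]; exact hV
    obtain ⟨a, ha, hne⟩ := Submodule.exists_mem_ne_zero_of_ne_bot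
      (LinearMap.ker_ne_bot_of_finrank_lt
        (f := (LinearMap.proj (R := ℝ) (φ := fun _ : Fin (n + 1) => ℝ) 0).comp W.subtype) hlt)
    exact ⟨a, a.2, by simpa using ha, by simpa using hne⟩
  have hapos : 0 < lorIP a a := by
    refine lt_of_le_of_ne ?_ fun h0 => ha (h a haW h0.symm)
    rw [lorIP_eq_sum_succ, ha0, mul_zero, sub_zero]
    exact Finset.sum_nonneg fun i _ => mul_self_nonneg _
  have hpos : ∀ b ∈ W, b ≠ 0 → 0 < lorIP b b := by
    intro b hb hb0
    by_contra hneg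
    have hlt : lorIP b b < 0 := lt_of_le_of_ne (not_lt.1 hneg) fun h0 => hb0 (h b hb h0)
    have expand : ∀ t : ℝ, lorIP (a + t • b) (a + t • b) =
        lorIP b b * (t * t) + 2 * lorIP a b * t + lorIP a a := fun t => by
      simp only [← lorForm_apply, map_add, map_smul, LinearMap.add_apply, LinearMap.smul_apply,
        smul_eq_mul, lorForm_comm b a]
      ring
    obtain ⟨t, ht⟩ := exists_quadratic_eq_zero (K := ℝ) (a := lorIP b b) (b := 2 * lorIP a b)
      (c := lorIP a a) hlt.ne
      ⟨√(discrim (lorIP b b) (2 * lorIP a b) (lorIP a a)), by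
        rw [Real.mul_self_sqrt]; rw [discrim]; nlinarith [sq_nonneg (lorIP a b)]⟩
    have hz := h _ (W.add_mem haW (W.smul_mem t hb)) ((expand t).trans ht)
    have hab : a = (-t) • b := by rw [neg_smul]; exact eq_neg_of_add_eq_zero_left hz
    rw [hab, ← lorForm_apply] at hapos
    simp only [map_smul, LinearMap.smul_apply, smul_eq_mul, lorForm_apply] at hapos
    nlinarith [sq_nonneg t]
  have hVW : (lorForm n).orthogonal W = V :=
    LinearMap.BilinForm.orthogonal_orthogonal (lorForm_nondegenerate n) (lorForm_isRefl n) V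
  have hcompl : IsCompl W ((lorForm n).orthogonal W) := by
    rw [LinearMap.BilinForm.isCompl_orthogonal_iff_disjoint (lorForm_isRefl n),
      Submodule.disjoint_def]
    intro x hx hx'
    exact h x hx (hx' x hx)
  obtain ⟨w, hw, v, hv, hwv⟩ := Submodule.mem_sup.1
    (hcompl.sup_eq_top ▸ Submodule.mem_top : (Pi.single 0 1 : Fin (n + 1) → ℝ) ∈ _)
  refine ⟨v, hVW ▸ hv, ?_⟩
  have hortho : lorForm n w v = 0 := hv w hw
  have he : lorIP (w + v) (w + v) = -1 := by
    rw [hwv, lorIP_eq_sum_succ]; simp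
  rw [← lorForm_apply] at he ⊢
  simp only [map_add, LinearMap.add_apply, lorForm_comm v w, hortho] at he
  have : 0 ≤ lorIP w w := by
    by_cases hw0 : w = 0
    · simp [hw0, lorIP]
    · exact (hpos w hw hw0).le
  rw [← lorForm_apply] at this
  linarith

/-- Existence of an orthonormal basis of a positive definite subspace. -/
lemma exists_orthonormal_of_pos {n : ℕ} (W : Submodule ℝ (Fin (n + 1) → ℝ))
    {m : ℕ} (hm : finrank ℝ W = m) (hpos : ∀ b ∈ W, b ≠ 0 → 0 < lorIP b b) :
    ∃ w : Fin m → Fin (n + 1) → ℝ, (∀ i, w i ∈ W) ∧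
      (∀ i j, lorForm n (w i) (w j) = if i = j then 1 else 0) ∧
      ∀ x ∈ W, x = ∑ i, lorForm n x (w i) • w i := by
  subst hm
  obtain ⟨v, hv⟩ := LinearMap.BilinForm.exists_orthogonal_basis
    (B := (lorForm n).restrict W) ⟨fun x y => lorForm_comm _ _⟩
  have hvo : ∀ i j, i ≠ j → lorForm n (v i) (v j) = 0 := fun i j hij => hv hij
  have hq : ∀ i, 0 < lorForm n (v i) (v i) := fun i =>
    hpos _ (v i).2 (by simpa using v.ne_zero i)
  have hs : ∀ i, √(lorForm n (v i) (v i)) ≠ 0 := fun i => (Real.sqrt_pos.2 (hq i)).ne'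
  have hss : ∀ i, √(lorForm n (v i) (v i)) * √(lorForm n (v i) (v i)) = lorForm n (v i) (v i) :=
    fun i => Real.mul_self_sqrt (hq i).le
  refine ⟨fun i => (√(lorForm n (v i) (v i)))⁻¹ • (v i : Fin (n + 1) → ℝ),
    fun i => W.smul_mem _ (v i).2, fun i j => ?_, fun x hx => ?_⟩
  · simp only [map_smul, LinearMap.smul_apply, smul_eq_mul]
    split_ifs with hij
    · subst hij
      rw [← mul_assoc, ← mul_inv, hss, inv_mul_cancel₀ (hq i).ne']
    · rw [hvo i j hij]; simp
  · have hrep : x = ∑ i, v.repr ⟨x, hx⟩ i • (v i : Fin (n + 1) → ℝ) := by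
      have := congrArg W.subtype (v.sum_repr ⟨x, hx⟩)
      rw [map_sum] at this
      exact this.symm
    have hcoef : ∀ i, lorForm n x (v i) = v.repr ⟨x, hx⟩ i * lorForm n (v i) (v i) := by
      intro i
      conv_lhs => rw [hrep]
      rw [map_sum, LinearMap.sum_apply, Finset.sum_eq_single i]
      · simp
      · intro j _ hj
        simp [hvo j i hj]
      · simp
    conv_lhs => rw [hrep]
    refine Finset.sum_congr rfl fun i _ => ?_
    rw [map_smul, smul_eq_mul, hcoef, smul_smul]
    congr 1
    have h1 := hss i
    have h2 := hs i
    set s := √(lorForm n (v i) (v i))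
    rw [← h1]
    field_simp

/-- The normal form of definite fold mapping. -/
def definiteFold (k n : ℕ) (hkn : k < n) (x : Fin (n + 1) → ℝ) (i : Fin (k + 1)) : ℝ :=
  if h : (i : ℕ) < k then x ⟨(i : ℕ) + 1, by omega⟩
  else x 0 ^ 2 + ∑ j : Fin (n + 1), if k + 1 ≤ (j : ℕ) then x j ^ 2 else 0

lemma definiteFold_castSucc {k n : ℕ} (hkn : k < n) (x : Fin (n + 1) → ℝ) (i : Fin k) :
    definiteFold k n hkn x i.castSucc = x ⟨(i : ℕ) + 1, by omega⟩ := by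
  simp [definiteFold]

lemma definiteFold_last {k n : ℕ} (hkn : k < n) (x : Fin (n + 1) → ℝ) :
    definiteFold k n hkn x (Fin.last k) =
      x 0 ^ 2 + ∑ j : Fin (n + 1), if k + 1 ≤ (j : ℕ) then x j ^ 2 else 0 := by
  simp [definiteFold]

lemma abs_apply_le_of_definiteFold_eq {k n : ℕ} (hkn : k < n) {x : Fin (n + 1) → ℝ}
    {c : Fin (k + 1) → ℝ} (hx : definiteFold k n hkn x = c) (j : Fin (n + 1)) :
    |x j| ≤ ‖c‖ + 1 := by
  have hnonneg : ∀ i : Fin (n + 1), 0 ≤ if k + 1 ≤ (i : ℕ) then x i ^ 2 else 0 := fun i => by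
    split_ifs <;> positivity
  have hlast := (congrFun hx (Fin.last k)).symm.trans (definiteFold_last hkn x)
  have hc : c (Fin.last k) ≤ ‖c‖ := (le_abs_self _).trans (norm_le_pi_norm c _)
  have hsum : 0 ≤ ∑ i : Fin (n + 1), if k + 1 ≤ (i : ℕ) then x i ^ 2 else 0 :=
    Finset.sum_nonneg fun i _ => hnonneg i
  have of_sq : x j ^ 2 ≤ ‖c‖ → |x j| ≤ ‖c‖ + 1 := fun h =>
    abs_le_of_sq_le_sq (by nlinarith [norm_nonneg c]) (by positivity)
  by_cases h0 : j = 0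
  · subst h0
    exact of_sq (by linarith)
  by_cases hj : k + 1 ≤ (j : ℕ)
  · apply of_sq
    have := Finset.single_le_sum (fun i _ => hnonneg i) (Finset.mem_univ j)
    rw [if_pos hj] at this
    nlinarith [sq_nonneg (x 0)]
  · have hj0 : (j : ℕ) ≠ 0 := fun h => h0 (Fin.ext h)
    have hval : c (Fin.castSucc ⟨(j : ℕ) - 1, by omega⟩) = x j := by
      rw [← hx, definiteFold_castSucc]
      congr 1
      ext
      simp only
      omega
    have := norm_le_pi_norm c (Fin.castSucc ⟨(j : ℕ) - 1, by omega⟩)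
    rw [hval, Real.norm_eq_abs] at this
    linarith

lemma isBounded_fiber_definiteFold {k n : ℕ} (hkn : k < n) (c : Fin (k + 1) → ℝ) :
    Bornology.IsBounded {x | definiteFold k n hkn x = c} := by
  refine isBounded_iff_forall_norm_le.2 ⟨‖c‖ + 1, fun x hx => ?_⟩
  exact (pi_norm_le_iff_of_nonneg (by positivity)).2 fun j =>
    abs_apply_le_of_definiteFold_eq hkn hx j

/-- An `𝒜`-equivalence preserves boundedness of fibers. -/
lemma AEquiv.isBounded_fiber {a b : ℕ} {f g : (Fin a → ℝ) → (Fin b → ℝ)} (hfg : AEquiv f g)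
    (hg : ∀ c, Bornology.IsBounded {x | g x = c}) (c : Fin b → ℝ) :
    Bornology.IsBounded {x | f x = c} := by
  obtain ⟨h, H, hh, -, -, -, rfl⟩ := hfg
  refine ((hg (H c)).isCompact_closure.image hh.continuous).isBounded.subset fun x hx => ?_
  refine ⟨h.symm x, subset_closure ?_, h.apply_symm_apply x⟩
  simpa using hx

lemma not_isBounded_of_line_subset {m : ℕ} {s : Set (Fin m → ℝ)} {a u : Fin m → ℝ} (hu : u ≠ 0)
    (hs : ∀ t : ℝ, a + t • u ∈ s) : ¬ Bornology.IsBounded s := by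
  intro hb
  obtain ⟨C, hC⟩ := isBounded_iff_forall_norm_le.1 hb
  have hu' : 0 < ‖u‖ := norm_pos_iff.2 hu
  have h1 := hC _ (hs ((C + ‖a‖ + 1) / ‖u‖))
  have hC0 : 0 ≤ C := (norm_nonneg _).trans h1
  have h2 : ‖((C + ‖a‖ + 1) / ‖u‖) • u‖ = C + ‖a‖ + 1 := by
    rw [norm_smul, Real.norm_of_nonneg (by positivity), div_mul_cancel₀ _ hu'.ne']
  have h3 := norm_sub_le (a + ((C + ‖a‖ + 1) / ‖u‖) • u) a
  rw [add_sub_cancel_left, h2] at h3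
  linarith

lemma sub_mem_recSub {n k : ℕ} (p : Fin (k + 1) → Fin (n + 1) → ℝ) (i : Fin (k + 1)) :
    p i - p 0 ∈ recSub p :=
  Submodule.subset_span ⟨i, rfl⟩

lemma finrank_orthogonal_recSub {n k : ℕ} {p : Fin (k + 1) → Fin (n + 1) → ℝ}
    (hgen : finrank ℝ (recSub p) = k) :
    finrank ℝ ((lorForm n).orthogonal (recSub p)) = n + 1 - k := by
  rw [LinearMap.BilinForm.finrank_orthogonal (lorForm_nondegenerate n), hgen, finrank_fin_fun]

lemma lorIP_sub_self {n : ℕ} (x y : Fin (n + 1) → ℝ) :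
    lorIP (x - y) (x - y) = lorIP x x - 2 * lorForm n x y + lorIP y y := by
  simp only [← lorForm_apply, map_sub, LinearMap.sub_apply, lorForm_comm y x]
  ring

lemma LorDSM_add_smul {n k : ℕ} (p : Fin (k + 1) → Fin (n + 1) → ℝ) {u : Fin (n + 1) → ℝ}
    (hu : u ∈ (lorForm n).orthogonal (recSub p)) (hu0 : lorIP u u = 0) (t : ℝ) :
    LorDSM p (p 0 + t • u) = LorDSM p (p 0) := by
  funext i
  have h1 : lorForm n u (p i - p 0) = 0 := by
    rw [lorForm_comm]; exact hu _ (sub_mem_recSub p i)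
  have h2 : p 0 + t • u - p i = t • u - (p i - p 0) := by abel
  have h3 : p 0 - p i = 0 - (p i - p 0) := by abel
  rw [← lorForm_apply] at hu0
  rw [LorDSM, LorDSM, h2, h3]
  generalize p i - p 0 = v at h1
  simp only [lorIP_sub_self]
  simp only [← lorForm_apply, map_smul, map_zero, LinearMap.smul_apply, LinearMap.zero_apply,
    h1, hu0, smul_zero]

lemma lTimeLike_of_aEquiv_definiteFold {k n : ℕ} (hkn : k < n)
    {p : Fin (k + 1) → Fin (n + 1) → ℝ} (hgen : finrank ℝ (recSub p) = k)
    (h : AEquiv (LorDSM p) (definiteFold k n hkn)) : LTimeLike (recSub p) := by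
  refine lTimeLike_of_orthogonal_anisotropic _
    (by rw [finrank_orthogonal_recSub hgen]; omega) fun u hu hu0 => ?_
  by_contra hne
  exact not_isBounded_of_line_subset (s := {x | LorDSM p x = LorDSM p (p 0)}) hne
    (LorDSM_add_smul p hu hu0) (h.isBounded_fiber (isBounded_fiber_definiteFold hkn) _)

/-- The affine change of coordinates `z ↦ ((z₀ - z_{i+1} + c_i) / 2)_i` followed by the shear that
subtracts a function `Q` of these coordinates from `z₀`. -/
def foldTargetEquiv {k : ℕ} (c : Fin k → ℝ) (Q : (Fin k → ℝ) → ℝ) :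
    (Fin (k + 1) → ℝ) ≃ (Fin (k + 1) → ℝ) where
  toFun z := Fin.snoc (α := fun _ => ℝ) (fun i => (z 0 - z i.succ + c i) / 2)
    (z 0 - Q fun i => (z 0 - z i.succ + c i) / 2)
  invFun t := Fin.cons (α := fun _ => ℝ) (t (Fin.last k) + Q fun i => t i.castSucc)
    (fun i => t (Fin.last k) + (Q fun i => t i.castSucc) + c i - 2 * t i.castSucc)
  left_inv z := by
    funext i
    cases i using Fin.cases with
    | zero => simp
    | succ i => simp; ring
  right_inv t := by
    have h : (fun i => (t (Fin.last k) + (Q fun i => t i.castSucc) -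
        (t (Fin.last k) + (Q fun i => t i.castSucc) + c i - 2 * t i.castSucc) + c i) / 2) =
        fun i => t i.castSucc := by funext i; ring
    funext i
    cases i using Fin.lastCases with
    | last => simp [h]
    | cast i => simpa using congrFun h i

lemma contDiff_foldTargetEquiv {k : ℕ} (c : Fin k → ℝ) {Q : (Fin k → ℝ) → ℝ}
    (hQ : ContDiff ℝ (⊤ : ℕ∞) Q) : ContDiff ℝ (⊤ : ℕ∞) (foldTargetEquiv c Q) := by
  refine contDiff_pi.2 fun i => ?_
  cases i using Fin.lastCases with
  | last =>
    simp only [foldTargetEquiv, Equiv.coe_fn_mk, Fin.snoc_last]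
    fun_prop
  | cast i =>
    simp only [foldTargetEquiv, Equiv.coe_fn_mk, Fin.snoc_castSucc]
    fun_prop

lemma contDiff_foldTargetEquiv_symm {k : ℕ} (c : Fin k → ℝ) {Q : (Fin k → ℝ) → ℝ}
    (hQ : ContDiff ℝ (⊤ : ℕ∞) Q) : ContDiff ℝ (⊤ : ℕ∞) (foldTargetEquiv c Q).symm := by
  refine contDiff_pi.2 fun i => ?_
  cases i using Fin.cases with
  | zero =>
    simp only [foldTargetEquiv, Equiv.coe_fn_symm_mk, Fin.cons_zero]
    fun_prop
  | succ i =>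
    simp only [foldTargetEquiv, Equiv.coe_fn_symm_mk, Fin.cons_succ]
    fun_prop

lemma sum_sq_fold_coordinates {k d : ℕ} (x : Fin (k + d + 1) → ℝ) (c : Fin (d + 1) → ℝ)
    (h0 : x 0 = c 0) (hs : ∀ i : Fin d, x (Fin.natAdd k i).succ = c i.succ) :
    x 0 ^ 2 + (∑ j : Fin (k + d + 1), if k + 1 ≤ (j : ℕ) then x j ^ 2 else 0) =
      ∑ i, c i ^ 2 := by
  rw [Fin.sum_univ_succ, Fin.sum_univ_add, Fin.sum_univ_succ (n := d), h0]
  have hlow : ∀ i : Fin k, ¬ k ≤ (i : ℕ) := fun i => by omega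
  simp [hs, hlow]

/-- If an orthonormal family `w` spans the orthogonal complement of the vectors `v i`, the functions
`⟨·, v i⟩` extend to linear coordinates in which the Lorentzian square is a function of these plus
a sum of squares. -/
lemma exists_splitting_coordinates {k d : ℕ} (v : Fin k → Fin (k + d + 1) → ℝ)
    (w : Fin (d + 1) → Fin (k + d + 1) → ℝ)
    (hw : ∀ i j, lorForm (k + d) (w i) (w j) = if i = j then 1 else 0)
    (hspan : ∀ x, (∀ i, lorForm (k + d) (v i) x = 0) →
      x = ∑ i, lorForm (k + d) x (w i) • w i) :
    ∃ e : (Fin (k + d + 1) → ℝ) ≃ₗ[ℝ] (Fin (k + d + 1) → ℝ),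
      (∀ y (i : Fin k), e y ⟨(i : ℕ) + 1, by omega⟩ = lorForm (k + d) y (v i)) ∧
      ∃ Q : (Fin k → ℝ) → ℝ, ContDiff ℝ (⊤ : ℕ∞) Q ∧
        ∀ y, lorIP y y - (Q fun i => lorForm (k + d) y (v i)) =
          e y 0 ^ 2 + ∑ j : Fin (k + d + 1), if k + 1 ≤ (j : ℕ) then e y j ^ 2 else 0 := by
  set B := lorForm (k + d) with hB
  let f : (Fin (k + d + 1) → ℝ) →ₗ[ℝ] (Fin (k + d + 1) → ℝ) := LinearMap.pi fun j =>
    if h : 1 ≤ (j : ℕ) ∧ (j : ℕ) ≤ k then B (v ⟨j - 1, by omega⟩)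
    else B (w ⟨j - k, by omega⟩)
  have hfv : ∀ y (i : Fin k), f y ⟨(i : ℕ) + 1, by omega⟩ = B y (v i) := fun y i => by
    have : 1 ≤ (i : ℕ) + 1 ∧ (i : ℕ) + 1 ≤ k := by omega
    simp [f, this, hB, lorForm_comm y]
  have hf0 : ∀ y, f y 0 = B y (w 0) := fun y => by
    simp [f, hB, lorForm_comm y]
  have hfw : ∀ y (i : Fin d), f y (Fin.natAdd k i).succ = B y (w i.succ) := fun y i => by
    have h1 : ¬ (1 ≤ k + (i : ℕ) + 1 ∧ k + (i : ℕ) + 1 ≤ k) := by omega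
    have h2 : (⟨k + (i : ℕ) + 1 - k, by omega⟩ : Fin (d + 1)) = i.succ := by
      ext; simp only [Fin.val_succ]; omega
    simp only [f, LinearMap.pi_apply, Fin.val_succ, Fin.val_natAdd, h1, dite_false, h2, hB,
      lorForm_comm y]
  have hinj : Function.Injective f := by
    refine (injective_iff_map_eq_zero f).2 fun y hy => ?_
    have h1 : ∀ i, B (v i) y = 0 := fun i => by
      rw [hB, lorForm_comm, ← hB, ← hfv, hy]; rfl
    have h2 : ∀ i, B y (w i) = 0 := fun i => by
      cases i using Fin.cases with
      | zero => rw [← hf0, hy]; rfl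
      | succ i => rw [← hfw, hy]; rfl
    rw [hspan y h1]
    simp [h2]
  let e := LinearEquiv.ofInjectiveEndo f hinj
  have he : ∀ y, e y = f y := fun y => rfl
  let place : (Fin k → ℝ) →ₗ[ℝ] (Fin (k + d + 1) → ℝ) := LinearMap.pi fun j =>
    if h : 1 ≤ (j : ℕ) ∧ (j : ℕ) ≤ k then LinearMap.proj ⟨j - 1, by omega⟩ else 0
  have hplace : ∀ a (i : Fin k), place a ⟨(i : ℕ) + 1, by omega⟩ = a i := fun a i => by
    have : 1 ≤ (i : ℕ) + 1 ∧ (i : ℕ) + 1 ≤ k := by omega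
    simp [place, this]
  let R : (Fin (k + d + 1) → ℝ) →ₗ[ℝ] (Fin (k + d + 1) → ℝ) :=
    LinearMap.id - ∑ i, (B (w i)).smulRight (w i)
  have hR : ∀ y, R y = y - ∑ i, B y (w i) • w i := fun y => by
    simp [R, LinearMap.sum_apply, hB, lorForm_comm y]
  let S : (Fin k → ℝ) →ₗ[ℝ] (Fin (k + d + 1) → ℝ) := R ∘ₗ e.symm.toLinearMap ∘ₗ place
  have hS : ∀ y, S (fun i => B y (v i)) = R y := fun y => by
    set y' := e.symm (place fun i => B y (v i)) with hy'
    have hz : R (y - y') = 0 := by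
      rw [hR, sub_eq_zero]
      refine hspan _ fun i => ?_
      have : B y' (v i) = B y (v i) := by
        rw [← hfv, ← he, hy', e.apply_symm_apply, hplace]
      rw [hB, lorForm_comm, ← hB, map_sub, LinearMap.sub_apply, this, sub_self]
    rw [map_sub, sub_eq_zero] at hz
    exact hz.symm
  refine ⟨e, fun y i => hfv y i, fun a => lorIP (S a) (S a), ?_, fun y => ?_⟩
  · have hSd : ContDiff ℝ (⊤ : ℕ∞) S := (LinearMap.toContinuousLinearMap S).contDiff
    have hSi : ∀ i, ContDiff ℝ (⊤ : ℕ∞) fun a => S a i := fun i => contDiff_pi.1 hSd i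
    unfold lorIP
    fun_prop
  · rw [sum_sq_fold_coordinates (e y) (fun i => B y (w i)) (hf0 y) (hfw y)]
    simp only [hS, ← lorForm_apply, ← hB, hR]
    have h1 : ∀ i, B (∑ j, B y (w j) • w j) (w i) = B y (w i) := fun i => by
      simp [map_sum, LinearMap.sum_apply, hw]
    have h2 : B y (∑ j, B y (w j) • w j) = ∑ j, B y (w j) ^ 2 := by
      simp [map_sum, pow_two]
    have h3 : B (∑ j, B y (w j) • w j) (∑ j, B y (w j) • w j) = ∑ j, B y (w j) ^ 2 := by
      rw [map_sum]
      simp only [map_smul, h1, smul_eq_mul, pow_two]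
    have h4 : B (∑ j, B y (w j) • w j) y = ∑ j, B y (w j) ^ 2 := by
      rw [hB, lorForm_comm, ← hB, h2]
    simp only [map_sub, LinearMap.sub_apply, h2, h3, h4]
    ring

lemma aEquiv_definiteFold_of_lTimeLike {k n : ℕ} (hkn : k < n)
    {p : Fin (k + 1) → Fin (n + 1) → ℝ} (hgen : finrank ℝ (recSub p) = k)
    (h : LTimeLike (recSub p)) : AEquiv (LorDSM p) (definiteFold k n hkn) := by
  obtain ⟨d, rfl⟩ := Nat.exists_eq_add_of_le hkn.le
  obtain ⟨u, hu, hu0⟩ := h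
  obtain ⟨w, -, hw, hspan⟩ := exists_orthonormal_of_pos
    ((lorForm (k + d)).orthogonal (recSub p)) (m := d + 1)
    (by rw [finrank_orthogonal_recSub hgen]; omega)
    (fun b hb hb0 => lorIP_self_pos_of_orthogonal hu0 (hb u hu) hb0)
  obtain ⟨e, he, Q, hQ, heQ⟩ := exists_splitting_coordinates (fun i : Fin k => p i.succ - p 0) w
    hw (fun x hx => hspan x fun y hy => by
      have hle : recSub p ≤ LinearMap.ker ((lorForm (k + d)).flip x) := by
        refine Submodule.span_le.2 ?_
        rintro _ ⟨i, rfl⟩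
        cases i using Fin.cases with
        | zero => simp
        | succ i => exact hx i
      exact hle hy)
  have hed : ContDiff ℝ (⊤ : ℕ∞) e := (LinearMap.toContinuousLinearMap e.toLinearMap).contDiff
  have hesd : ContDiff ℝ (⊤ : ℕ∞) e.symm :=
    (LinearMap.toContinuousLinearMap e.symm.toLinearMap).contDiff
  refine ⟨e.symm.toEquiv.trans (Equiv.addRight (p 0)),
    foldTargetEquiv (fun i => lorIP (p i.succ - p 0) (p i.succ - p 0)) Q,
    hesd.add contDiff_const, ?_, contDiff_foldTargetEquiv _ hQ,
    contDiff_foldTargetEquiv_symm _ hQ, ?_⟩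
  · exact hed.comp (contDiff_id.add contDiff_const)
  · funext t
    obtain ⟨y, rfl⟩ := e.surjective t
    have hL0 : LorDSM p (y + p 0) 0 = lorIP y y := by simp [LorDSM]
    have hcoord : ∀ i : Fin k, (LorDSM p (y + p 0) 0 - LorDSM p (y + p 0) i.succ +
        lorIP (p i.succ - p 0) (p i.succ - p 0)) / 2 =
        lorForm (k + d) y (p i.succ - p 0) := fun i => by
      have : y + p 0 - p i.succ = y - (p i.succ - p 0) := by abel
      rw [hL0, LorDSM, this, lorIP_sub_self]
      ring
    funext i
    cases i using Fin.lastCases with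
    | last =>
      rw [definiteFold_last, ← heQ]
      rw [← hL0]
      simp [foldTargetEquiv, hcoord]
    | cast i => simp [definiteFold_castSucc, he, foldTargetEquiv, hcoord]

theorem theorem1_1a (k n : ℕ) (hk : 1 ≤ k) (hkn : k < n)
    (p : Fin (k + 1) → Fin (n + 1) → ℝ)
    (hgen : Module.finrank ℝ (recSub p) = k) :
    AEquiv (LorDSM p)
        (fun (x : Fin (n + 1) → ℝ) (i : Fin (k + 1)) =>
          if h : (i : ℕ) < k then x ⟨(i : ℕ) + 1, by omega⟩
          else x 0 ^ 2 + ∑ j : Fin (n + 1), if k + 1 ≤ (j : ℕ) then x j ^ 2 else 0)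
      ↔ LTimeLike (recSub p) := by
  exact ⟨lTimeLike_of_aEquiv_definiteFold hkn hgen, aEquiv_definiteFold_of_lTimeLike hkn hgen⟩
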